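/- arXiv:math/0004028 — 2 statements merged into one kernel-verified Lean document; each statement's English description precedes it below -/
import Mathlib

section
/- Let k ≥ 1 and let Λ be a group of isometries of Euclidean space ℝ^k acting properly discontinuously (for every compact K ⊆ ℝ^k the set {λ ∈ Λ : λ(K) ∩ K ≠ ∅} is finite) and cocompactly (there is a compact set K ⊆ ℝ^k with ⋃_{λ∈Λ} λ(K) = ℝ^k). Let ℌ be a nonempty family of affine hyperplanes of ℝ^k (affine subspaces of dimension k−1) that is Λ-invariant (λ(H) ∈ ℌ for all λ ∈ Λ, H ∈ ℌ) and such that for every H ∈ ℌ the orthogonal reflection of ℝ^k across H belongs to Λ. Then every H ∈ ℌ is contained in an infinite family of pairwise parallel hyperplanes of ℌ; that is, for each H ∈ ℌ the set {H′ ∈ ℌ : H′ has the same direction subspace as H} is infinite. -/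
open Filter Topology

section

variable {V : Type*} [NormedAddCommGroup V] [InnerProductSpace ℝ V]

/-- A set of vectors with only finitely many mutual inner products is finite. -/
theorem Set.Finite.of_finite_inner [FiniteDimensional ℝ V] {U : Set V} {A : Set ℝ}
    (hA : A.Finite) (h : ∀ x ∈ U, ∀ y ∈ U, inner ℝ x y ∈ A) : U.Finite := by
  obtain ⟨b, hbU, hspan, hli⟩ := exists_linearIndependent ℝ U
  have : Finite b := hli.finite
  have : Finite A := hA
  let φ : U → b → A := fun x y => ⟨inner ℝ (y : V) (x : V), h y (hbU y.2) x x.2⟩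
  have hφ : Function.Injective φ := by
    intro x y hxy
    have hmem : (x : V) - y ∈ Submodule.span ℝ b := by
      rw [hspan]
      exact sub_mem (Submodule.subset_span x.2) (Submodule.subset_span y.2)
    have horth : (x : V) - y ∈ (Submodule.span ℝ b)ᗮ := by
      rw [Submodule.mem_orthogonal]
      intro u hu
      induction hu using Submodule.span_induction with
      | mem u hu =>
        have := congrArg Subtype.val (congrFun hxy ⟨u, hu⟩)
        simpa [φ, inner_sub_right, sub_eq_zero] using this
      | zero => simp
      | add u v _ _ hu hv => rw [inner_add_left, hu, hv, add_zero]
      | smul c u _ hu => rw [real_inner_smul_left, hu, mul_zero]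
    have h0 : inner ℝ ((x : V) - y) ((x : V) - y) = 0 :=
      (Submodule.mem_orthogonal _ _).1 horth _ hmem
    exact Subtype.ext (sub_eq_zero.1 (inner_self_eq_zero.1 h0))
  exact Finite.of_injective φ hφ

theorem Submodule.eq_or_eq_neg_of_finrank_eq_one {S : Submodule ℝ V}
    (hS : Module.finrank ℝ S = 1) {x y : V} (hx : x ∈ S) (hy : y ∈ S)
    (hx1 : ‖x‖ = 1) (hy1 : ‖y‖ = 1) : y = x ∨ y = -x := by
  have hx0 : (⟨x, hx⟩ : S) ≠ 0 := by
    intro h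
    have : x = 0 := congrArg Subtype.val h
    simp [this] at hx1
  obtain ⟨c, hc⟩ := (finrank_eq_one_iff_of_nonzero' _ hx0).1 hS ⟨y, hy⟩
  have hc' : c • x = y := congrArg Subtype.val hc
  have hc1 : |c| = 1 := by
    have := congrArg norm hc'
    rwa [norm_smul, hx1, hy1, mul_one, Real.norm_eq_abs] at this
  rcases eq_or_eq_neg_of_abs_eq hc1 with rfl | rfl
  · exact Or.inl (by simpa using hc'.symm)
  · exact Or.inr (by simpa using hc'.symm)

theorem Submodule.exists_norm_eq_one_of_finrank_eq_one {S : Submodule ℝ V}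
    (hS : Module.finrank ℝ S = 1) : ∃ x ∈ S, ‖x‖ = 1 := by
  obtain ⟨v, hv, -⟩ := finrank_eq_one_iff'.1 hS
  have hv0 : (v : V) ≠ 0 := by simpa using hv
  exact ⟨(‖(v : V)‖⁻¹ : ℝ) • (v : V), S.smul_mem _ v.2, norm_smul_inv_norm hv0⟩

/-- The image of an affine subspace under an isometry, which is affine by Mazur–Ulam. -/
noncomputable def IsometryEquiv.mapAffineSubspace (g : V ≃ᵢ V) (H : AffineSubspace ℝ V) :
    AffineSubspace ℝ V :=
  H.map (g.toRealAffineIsometryEquiv.toAffineEquiv : V →ᵃ[ℝ] V)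

namespace IsometryEquiv

@[simp]
theorem coe_mapAffineSubspace (g : V ≃ᵢ V) (H : AffineSubspace ℝ V) :
    (g.mapAffineSubspace H : Set V) = g '' H :=
  AffineSubspace.coe_map _ _

theorem mapAffineSubspace_mul (g h : V ≃ᵢ V) (H : AffineSubspace ℝ V) :
    (g * h).mapAffineSubspace H = g.mapAffineSubspace (h.mapAffineSubspace H) :=
  SetLike.coe_injective (by simp [Set.image_image])

theorem mapAffineSubspace_inv_self (g : V ≃ᵢ V) (H : AffineSubspace ℝ V) :
    g⁻¹.mapAffineSubspace (g.mapAffineSubspace H) = H := by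
  rw [← mapAffineSubspace_mul, inv_mul_cancel]
  exact SetLike.coe_injective (by simp)

theorem mapAffineSubspace_self_inv (g : V ≃ᵢ V) (H : AffineSubspace ℝ V) :
    g.mapAffineSubspace (g⁻¹.mapAffineSubspace H) = H := by
  simpa using mapAffineSubspace_inv_self g⁻¹ H

theorem direction_mapAffineSubspace (g : V ≃ᵢ V) (H : AffineSubspace ℝ V) :
    (g.mapAffineSubspace H).direction = H.direction.map
      (g.toRealAffineIsometryEquiv.linearIsometryEquiv.toLinearEquiv : V →ₗ[ℝ] V) :=
  AffineSubspace.map_direction _ _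

theorem map_mem_orthogonal_direction_mapAffineSubspace (g : V ≃ᵢ V) {H : AffineSubspace ℝ V}
    {n : V} (hn : n ∈ H.directionᗮ) :
    g.toRealAffineIsometryEquiv.linearIsometryEquiv n ∈ (g.mapAffineSubspace H).directionᗮ := by
  rw [direction_mapAffineSubspace, Submodule.mem_orthogonal]
  rintro _ ⟨u, hu, rfl⟩
  exact (LinearIsometryEquiv.inner_map_map _ u n).trans ((Submodule.mem_orthogonal _ _).1 hn u hu)

end IsometryEquiv

namespace AffineSubspace

theorem finrank_orthogonal_direction_eq_one [FiniteDimensional ℝ V] {H : AffineSubspace ℝ V}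
    (hH : Module.finrank ℝ H.direction + 1 = Module.finrank ℝ V) :
    Module.finrank ℝ H.directionᗮ = 1 :=
  Submodule.finrank_add_finrank_orthogonal' hH

/-- Two non-parallel hyperplanes meet. -/
theorem inter_nonempty_of_direction_ne [FiniteDimensional ℝ V] {H₁ H₂ : AffineSubspace ℝ V}
    (h₁ : (H₁ : Set V).Nonempty) (h₂ : (H₂ : Set V).Nonempty)
    (hd₁ : Module.finrank ℝ H₁.direction + 1 = Module.finrank ℝ V)
    (hd₂ : Module.finrank ℝ H₂.direction + 1 = Module.finrank ℝ V)
    (hne : H₁.direction ≠ H₂.direction) : ((H₁ : Set V) ∩ H₂).Nonempty := by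
  refine inter_nonempty_of_nonempty_of_sup_direction_eq_top h₁ h₂ ?_
  have hlt : H₁.direction < H₁.direction ⊔ H₂.direction := by
    refine lt_of_le_of_ne le_sup_left fun h => hne ?_
    exact (Submodule.eq_of_le_of_finrank_eq (h ▸ le_sup_right) (by omega)).symm
  have := Submodule.finrank_lt_finrank_of_lt hlt
  have := Submodule.finrank_le (H₁.direction ⊔ H₂.direction)
  exact Submodule.eq_top_of_finrank_eq (by omega)

/-- The fixed points of the reflection across `H` are the points of `H`. -/
theorem mem_of_reflection_apply_eq [FiniteDimensional ℝ V] {H : AffineSubspace ℝ V}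
    (hne : (H : Set V).Nonempty) {ρ : V → V}
    (hρ : ∀ x ∈ H, ∀ w ∈ H.directionᗮ, ρ (x + w) = x - w) {y : V} (hy : ρ y = y) : y ∈ H := by
  obtain ⟨p, hp⟩ := hne
  obtain ⟨v, hv, w, hw, hvw⟩ := H.direction.exists_add_mem_mem_orthogonal (y - p)
  have hx : v + p ∈ H := vadd_mem_of_mem_direction hv hp
  have hyw : y = v + p + w := by
    rw [eq_add_of_sub_eq hvw]; abel
  have h := hρ _ hx w hw
  rw [← hyw, hy] at h
  have hw0 : w = 0 := by
    have h2 := hyw.symm.trans h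
    rw [sub_eq_add_neg, add_right_inj] at h2
    have : IsAddTorsionFree V := .of_isTorsionFree ℝ V
    exact self_eq_neg.1 h2
  rw [hyw, hw0, add_zero]
  exact hx

/-- Points far from a proper affine subspace exist. -/
theorem exists_lt_infDist {H : AffineSubspace ℝ V} (hne : (H : Set V).Nonempty) {n : V}
    (hn : n ∈ H.directionᗮ) (hn1 : ‖n‖ = 1) (C : ℝ) : ∃ x, C < Metric.infDist x (H : Set V) := by
  obtain ⟨p, hp⟩ := hne
  refine ⟨p + (C + 1) • n, (lt_add_one C).trans_le
    ((Metric.le_infDist ⟨p, hp⟩).2 fun {y} hy => ?_)⟩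
  have h0 : inner ℝ (p - y) n = 0 :=
    (Submodule.mem_orthogonal _ _).1 hn _ (vsub_mem_direction hp hy)
  have h1 : inner ℝ (p + (C + 1) • n - y) n = C + 1 := by
    rw [add_sub_right_comm, inner_add_left, h0, real_inner_smul_left,
      real_inner_self_eq_norm_sq, hn1]
    ring
  have h2 := real_inner_le_norm (p + (C + 1) • n - y) n
  rwa [h1, hn1, mul_one, ← dist_eq_norm] at h2

end AffineSubspace

/-- Only finitely many mirrors of a properly discontinuous group meet a given compact set. -/
theorem finite_mirrors_meeting_compact [FiniteDimensional ℝ V] {Λ : Subgroup (V ≃ᵢ V)}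
    {ℌ : Set (AffineSubspace ℝ V)} {K : Set V}
    (hK : {g : V ≃ᵢ V | g ∈ Λ ∧ ((g '' K) ∩ K).Nonempty}.Finite)
    (hne : ∀ H ∈ ℌ, (H : Set V).Nonempty)
    (hrefl : ∀ H ∈ ℌ, ∃ ρ : V ≃ᵢ V, ρ ∈ Λ ∧ ∀ x ∈ H, ∀ w ∈ H.directionᗮ, ρ (x + w) = x - w) :
    {H ∈ ℌ | ((H : Set V) ∩ K).Nonempty}.Finite := by
  choose! ρ hρΛ hρ using hrefl
  have hfix : ∀ H ∈ ℌ, ∀ x, x ∈ H ↔ ρ H x = x := fun H hH x =>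
    ⟨fun hx => by simpa using hρ H hH x hx 0 (zero_mem _),
      AffineSubspace.mem_of_reflection_apply_eq (hne H hH) (hρ H hH)⟩
  refine Set.Finite.of_finite_image (f := ρ) (hK.subset ?_) ?_
  · rintro _ ⟨H, ⟨hH, x, hxH, hxK⟩, rfl⟩
    exact ⟨hρΛ H hH, x, ⟨x, hxK, (hfix H hH x).1 hxH⟩, hxK⟩
  · intro H₁ h₁ H₂ h₂ h
    ext x
    rw [hfix H₁ h₁.1, hfix H₂ h₂.1, h]

/-- If finitely many members of an invariant family of hyperplanes meet a compact set whose
translates cover the space, then the hyperplanes of the family have finitely many directions. -/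
theorem finite_directions [FiniteDimensional ℝ V] {Λ : Subgroup (V ≃ᵢ V)}
    {ℌ : Set (AffineSubspace ℝ V)} {K : Set V}
    (hcover : ∀ x, ∃ g ∈ Λ, g x ∈ K)
    (hfin : {H ∈ ℌ | ((H : Set V) ∩ K).Nonempty}.Finite)
    (hne : ∀ H ∈ ℌ, (H : Set V).Nonempty)
    (hdim : ∀ H ∈ ℌ, Module.finrank ℝ H.direction + 1 = Module.finrank ℝ V)
    (hinv : ∀ g ∈ Λ, ∀ H ∈ ℌ, g.mapAffineSubspace H ∈ ℌ) :
    (AffineSubspace.direction '' ℌ).Finite := by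
  have hrank := fun H hH => AffineSubspace.finrank_orthogonal_direction_eq_one (hdim H hH)
  let N : AffineSubspace ℝ V → Set V := fun H => {n | n ∈ H.directionᗮ ∧ ‖n‖ = 1}
  have hN : ∀ H ∈ ℌ, (N H).Finite := by
    intro H hH
    obtain ⟨n, hn, hn1⟩ := Submodule.exists_norm_eq_one_of_finrank_eq_one (hrank H hH)
    refine (Set.toFinite {n, -n}).subset fun m hm => ?_
    exact Submodule.eq_or_eq_neg_of_finrank_eq_one (hrank H hH) hn hm.1 hn1 hm.2
  have hNK : (⋃ H ∈ {H ∈ ℌ | ((H : Set V) ∩ K).Nonempty}, N H).Finite :=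
    hfin.biUnion fun H hH => hN H hH.1
  have hU : (⋃ H ∈ ℌ, N H).Finite := by
    refine Set.Finite.of_finite_inner ((hNK.image2 (inner ℝ) hNK).union
      (Set.toFinite {1, -1})) ?_
    simp only [Set.mem_iUnion]
    rintro n ⟨H₁, h₁, hn, hn1⟩ m ⟨H₂, h₂, hm, hm1⟩
    by_cases hd : H₁.direction = H₂.direction
    · right
      rcases Submodule.eq_or_eq_neg_of_finrank_eq_one (hrank H₁ h₁) hn (hd ▸ hm) hn1 hm1
        with rfl | rfl <;> simp [hn1]
    · left
      obtain ⟨p, hp₁, hp₂⟩ := AffineSubspace.inter_nonempty_of_direction_ne (hne H₁ h₁)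
        (hne H₂ h₂) (hdim H₁ h₁) (hdim H₂ h₂) hd
      obtain ⟨g, hg, hgp⟩ := hcover p
      have key : ∀ H ∈ ℌ, p ∈ H → ∀ u ∈ N H,
          g.toRealAffineIsometryEquiv.linearIsometryEquiv u ∈
            ⋃ H ∈ {H ∈ ℌ | ((H : Set V) ∩ K).Nonempty}, N H := by
        intro H hH hpH u hu
        refine Set.mem_biUnion (x := g.mapAffineSubspace H) ⟨hinv g hg H hH, g p, ?_, hgp⟩
          ⟨g.map_mem_orthogonal_direction_mapAffineSubspace hu.1, by simpa using hu.2⟩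
        rw [IsometryEquiv.coe_mapAffineSubspace]
        exact Set.mem_image_of_mem g hpH
      exact ⟨_, key H₁ h₁ hp₁ n ⟨hn, hn1⟩, _, key H₂ h₂ hp₂ m ⟨hm, hm1⟩,
        LinearIsometryEquiv.inner_map_map _ n m⟩
  refine (hU.image fun n => (Submodule.span ℝ {n})ᗮ).subset ?_
  rintro _ ⟨H, hH, rfl⟩
  obtain ⟨n, hn, hn1⟩ := Submodule.exists_norm_eq_one_of_finrank_eq_one (hrank H hH)
  refine ⟨n, Set.mem_biUnion hH ⟨hn, hn1⟩, ?_⟩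
  have hn0 : n ≠ 0 := fun h => by simp [h] at hn1
  have hspan : Submodule.span ℝ {n} = H.directionᗮ :=
    Submodule.eq_of_le_of_finrank_eq (by simpa using hn)
      ((finrank_span_singleton hn0).trans (hrank H hH).symm)
  simp only [hspan, Submodule.orthogonal_orthogonal]

/-- An affine subspace with a unit normal has infinite orbit under a cocompact group. -/
theorem infinite_orbit_of_cocompact {Λ : Subgroup (V ≃ᵢ V)} {K : Set V} (hK : IsCompact K)
    (hcover : ∀ x, ∃ g ∈ Λ, g x ∈ K) {H : AffineSubspace ℝ V} (hne : (H : Set V).Nonempty)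
    {n : V} (hn : n ∈ H.directionᗮ) (hn1 : ‖n‖ = 1) :
    ((fun g : V ≃ᵢ V => g.mapAffineSubspace H) '' Λ).Infinite := by
  intro hfin
  have hbdd : ∀ H' : AffineSubspace ℝ V, ∃ C, ∀ y ∈ K, Metric.infDist y (H' : Set V) ≤ C := by
    intro H'
    obtain ⟨C, hC⟩ := (hK.image (Metric.continuous_infDist_pt (H' : Set V))).bddAbove
    exact ⟨C, fun y hy => hC (Set.mem_image_of_mem _ hy)⟩
  choose C hC using hbdd
  obtain ⟨B, hB⟩ := (hfin.image C).bddAbove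
  obtain ⟨x, hx⟩ := AffineSubspace.exists_lt_infDist hne hn hn1 B
  obtain ⟨g, hg, hgx⟩ := hcover x
  have h1 := hC (g.mapAffineSubspace H) _ hgx
  rw [IsometryEquiv.coe_mapAffineSubspace, Metric.infDist_image g.isometry] at h1
  have h2 := hB (Set.mem_image_of_mem C (Set.mem_image_of_mem _ hg))
  exact absurd (h1.trans h2) hx.not_ge

/-- Isometries preserving a family of affine subspaces preserve finiteness of its parallel
classes. -/
theorem finite_parallel_mapAffineSubspace {Λ : Subgroup (V ≃ᵢ V)} {ℌ : Set (AffineSubspace ℝ V)}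
    (hinv : ∀ g ∈ Λ, ∀ H ∈ ℌ, g.mapAffineSubspace H ∈ ℌ) {H : AffineSubspace ℝ V}
    (hfin : {H' ∈ ℌ | H'.direction = H.direction}.Finite) {g : V ≃ᵢ V} (hg : g ∈ Λ) :
    {H' ∈ ℌ | H'.direction = (g.mapAffineSubspace H).direction}.Finite := by
  refine (hfin.image g.mapAffineSubspace).subset ?_
  rintro H' ⟨hH', hd⟩
  refine ⟨g⁻¹.mapAffineSubspace H', ⟨hinv _ (Λ.inv_mem hg) _ hH', ?_⟩,
    g.mapAffineSubspace_self_inv H'⟩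
  rw [IsometryEquiv.direction_mapAffineSubspace, hd,
    ← IsometryEquiv.direction_mapAffineSubspace, g.mapAffineSubspace_inv_self]

end

/-- Lemma 7.3 (concluding assertion): if a discrete cocompact group `Λ` of isometries of
`ℝ^k` leaves invariant a family `ℌ` of affine hyperplanes and contains the reflections
across all of them, then every hyperplane in `ℌ` belongs to an infinite parallel family
in `ℌ`. -/
theorem stmt_8 (k : ℕ) (hk : 1 ≤ k)
    (Λ : Subgroup (EuclideanSpace ℝ (Fin k) ≃ᵢ EuclideanSpace ℝ (Fin k)))
    (hdisc : ∀ K : Set (EuclideanSpace ℝ (Fin k)), IsCompact K →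
      {g : EuclideanSpace ℝ (Fin k) ≃ᵢ EuclideanSpace ℝ (Fin k) |
        g ∈ Λ ∧ ((g '' K) ∩ K).Nonempty}.Finite)
    (hcocpt : ∃ K : Set (EuclideanSpace ℝ (Fin k)), IsCompact K ∧
      (⋃ g ∈ Λ, (g : EuclideanSpace ℝ (Fin k) ≃ᵢ EuclideanSpace ℝ (Fin k)) '' K) = Set.univ)
    (ℌ : Set (AffineSubspace ℝ (EuclideanSpace ℝ (Fin k)))) (hne : ℌ.Nonempty)
    (hhyp : ∀ H ∈ ℌ, (H : Set (EuclideanSpace ℝ (Fin k))).Nonempty ∧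
      Module.finrank ℝ H.direction = k - 1)
    (hinv : ∀ g : EuclideanSpace ℝ (Fin k) ≃ᵢ EuclideanSpace ℝ (Fin k), g ∈ Λ → ∀ H ∈ ℌ,
      ∃ H' ∈ ℌ, (H' : Set (EuclideanSpace ℝ (Fin k))) = g '' (H : Set (EuclideanSpace ℝ (Fin k))))
    (hrefl : ∀ H ∈ ℌ, ∃ ρ : EuclideanSpace ℝ (Fin k) ≃ᵢ EuclideanSpace ℝ (Fin k), ρ ∈ Λ ∧
      ∀ x ∈ H, ∀ w ∈ H.directionᗮ, ρ (x + w) = x - w) :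
    ∀ H ∈ ℌ, {H' ∈ ℌ | H'.direction = H.direction}.Infinite := by
  obtain ⟨K, hK, hKcover⟩ := hcocpt
  have hcover : ∀ x, ∃ g ∈ Λ, g x ∈ K := by
    intro x
    have hx : x ∈ ⋃ g ∈ Λ, (g : EuclideanSpace ℝ (Fin k) ≃ᵢ _) '' K := hKcover ▸ Set.mem_univ x
    simp only [Set.mem_iUnion] at hx
    obtain ⟨g, hg, y, hy, rfl⟩ := hx
    exact ⟨g⁻¹, Λ.inv_mem hg, by simpa using hy⟩
  have hinv' : ∀ g ∈ Λ, ∀ H ∈ ℌ, g.mapAffineSubspace H ∈ ℌ := by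
    intro g hg H hH
    obtain ⟨H', hH', h⟩ := hinv g hg H hH
    rwa [← SetLike.coe_injective (h.trans (g.coe_mapAffineSubspace H).symm)]
  have hdim : ∀ H ∈ ℌ,
      Module.finrank ℝ H.direction + 1 = Module.finrank ℝ (EuclideanSpace ℝ (Fin k)) := by
    intro H hH
    rw [(hhyp H hH).2, finrank_euclideanSpace_fin]
    omega
  have hdir := finite_directions hcover
    (finite_mirrors_meeting_compact (hdisc K hK) (fun H hH => (hhyp H hH).1) hrefl)
    (fun H hH => (hhyp H hH).1) hdim hinv'
  intro H hH hfin
  obtain ⟨n, hn, hn1⟩ := Submodule.exists_norm_eq_one_of_finrank_eq_one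
    (AffineSubspace.finrank_orthogonal_direction_eq_one (hdim H hH))
  refine infinite_orbit_of_cocompact hK hcover (hhyp H hH).1 hn hn1
    (Set.Finite.of_finite_fibers AffineSubspace.direction (hdir.subset ?_) ?_)
  · rintro _ ⟨_, ⟨g, hg, rfl⟩, rfl⟩
    exact Set.mem_image_of_mem _ (hinv' g hg H hH)
  · rintro _ ⟨_, ⟨g, hg, rfl⟩, rfl⟩
    refine (finite_parallel_mapAffineSubspace hinv' hfin hg).subset ?_
    rintro _ ⟨⟨g', hg', rfl⟩, hd⟩
    exact ⟨hinv' g' hg' H hH, hd⟩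
end

section
/- Let k ≥ 1 and let Λ be a group of isometries of Euclidean space ℝ^k acting properly discontinuously (for every compact K ⊆ ℝ^k the set {λ ∈ Λ : λ(K) ∩ K ≠ ∅} is finite) and cocompactly (there is a compact set K ⊆ ℝ^k with ⋃_{λ∈Λ} λ(K) = ℝ^k). Call a function h : ℝ^k → ℝ Λ-invariant if h ∘ λ = h for every λ ∈ Λ. Then for every Λ-invariant C^∞ function f : ℝ^k → ℝ and every ε > 0 there exist finitely many C^∞ functions g_1, …, g_m : ℝ^k → ℝ and real numbers c_1, …, c_m with Δg_i = c_i·g_i for each i (where Δh(x) = ∑_{j=1}^k ∂²h/∂x_j²(x) is the Euclidean Laplacian), such that g := g_1 + ⋯ + g_m is Λ-invariant and |f(x) − g(x)| ≤ ε for all x ∈ ℝ^k. -/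
open Filter Topology
open MeasureTheory
open scoped InnerProductSpace Convolution

section KernelOperator

variable {X : Type*} [TopologicalSpace X] [CompactSpace X]
  {H : Type*} [NormedAddCommGroup H] [InnerProductSpace ℝ H]

/-- A continuous family `κ` of vectors defines the operator `h ↦ (x ↦ ⟪κ x, h⟫)`. -/
noncomputable def innerFamilyCLM (κ : C(X, H)) : H →L[ℝ] C(X, ℝ) :=
  LinearMap.mkContinuous
    { toFun := fun h => ⟨fun x => ⟪κ x, h⟫_ℝ, by fun_prop⟩
      map_add' := fun h g => by ext x; simp [inner_add_right]
      map_smul' := fun c h => by ext x; simp [inner_smul_right] } ‖κ‖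
    (fun h => by
      rw [ContinuousMap.norm_le _ (by positivity)]
      intro x
      exact (norm_inner_le_norm _ _).trans (by gcongr; exact κ.norm_coe_le_norm x))

/-- By Arzelà–Ascoli, the operator attached to a continuous family is compact. -/
lemma isCompactOperator_innerFamilyCLM (κ : C(X, H)) :
    IsCompactOperator (innerFamilyCLM κ) := by
  set e := ContinuousMap.linearIsometryBoundedOfCompact X ℝ ℝ
  set A : Set (BoundedContinuousFunction X ℝ) :=
    (fun h => e (innerFamilyCLM κ h)) '' Metric.ball 0 1
  have hA : IsCompact (closure A) := by
    refine BoundedContinuousFunction.arzela_ascoli (Metric.closedBall 0 ‖κ‖)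
      (isCompact_closedBall _ _) A ?_ ?_
    · rintro _ x ⟨h, hh, rfl⟩
      rw [mem_ball_zero_iff] at hh
      rw [mem_closedBall_zero_iff]
      change ‖⟪κ x, h⟫_ℝ‖ ≤ _
      calc ‖⟪κ x, h⟫_ℝ‖ ≤ ‖κ x‖ * ‖h‖ := norm_inner_le_norm _ _
        _ ≤ ‖κ‖ * 1 := by gcongr; exact κ.norm_coe_le_norm x
        _ = ‖κ‖ := mul_one _
    · intro x
      rw [Metric.equicontinuousAt_iff_right]
      intro ε hε
      filter_upwards [κ.continuous.continuousAt (Metric.ball_mem_nhds _ hε)] with y hy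
      rintro ⟨_, h, hh, rfl⟩
      rw [mem_ball_zero_iff] at hh
      change dist ⟪κ x, h⟫_ℝ ⟪κ y, h⟫_ℝ < ε
      rw [dist_eq_norm, ← inner_sub_left]
      calc ‖⟪κ x - κ y, h⟫_ℝ‖ ≤ ‖κ x - κ y‖ * ‖h‖ := norm_inner_le_norm _ _
        _ ≤ ‖κ x - κ y‖ * 1 := by gcongr
        _ < ε := by rw [mul_one, ← dist_eq_norm, dist_comm]; exact hy
  refine ⟨e.symm '' closure A, hA.image e.symm.continuous, ?_⟩
  filter_upwards [Metric.ball_mem_nhds (0 : H) one_pos] with h hh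
  exact ⟨e (innerFamilyCLM κ h), subset_closure ⟨h, hh, rfl⟩, by simp⟩

end KernelOperator

section L2

variable {X : Type*} [TopologicalSpace X] [CompactSpace X]
  [MeasurableSpace X] [BorelSpace X] (μ : Measure X) [IsFiniteMeasure μ]

/-- The integral operator `h ↦ (x ↦ ∫ K (x, y) h y ∂μ)` from `L²` to continuous functions. -/
noncomputable def integralOp (K : C(X × X, ℝ)) : Lp ℝ 2 μ →L[ℝ] C(X, ℝ) :=
  innerFamilyCLM
    ⟨fun x => ContinuousMap.toLp 2 μ ℝ (K.curry x),
      (ContinuousMap.toLp 2 μ ℝ).continuous.comp K.curry.continuous⟩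

lemma integralOp_apply (K : C(X × X, ℝ)) (h : Lp ℝ 2 μ) (x : X) :
    integralOp μ K h x = ∫ y, K (x, y) * h y ∂μ := by
  change ⟪ContinuousMap.toLp 2 μ ℝ (K.curry x), h⟫_ℝ = _
  rw [L2.inner_def]
  refine integral_congr_ae ?_
  filter_upwards [ContinuousMap.coeFn_toLp (p := 2) (𝕜 := ℝ) μ (K.curry x)] with y hy
  rw [hy]
  simp [mul_comm]

lemma integralOp_toLp_apply (K : C(X × X, ℝ)) (u : C(X, ℝ)) (x : X) :
    integralOp μ K (ContinuousMap.toLp 2 μ ℝ u) x = ∫ y, K (x, y) * u y ∂μ := by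
  rw [integralOp_apply]
  refine integral_congr_ae ?_
  filter_upwards [ContinuousMap.coeFn_toLp (p := 2) (𝕜 := ℝ) μ u] with y hy
  rw [hy]

/-- The integral operator as an endomorphism of `L²`. -/
noncomputable def integralEnd (K : C(X × X, ℝ)) : Lp ℝ 2 μ →L[ℝ] Lp ℝ 2 μ :=
  (ContinuousMap.toLp 2 μ ℝ).comp (integralOp μ K)

lemma isCompactOperator_integralEnd (K : C(X × X, ℝ)) :
    IsCompactOperator (integralEnd μ K) :=
  (isCompactOperator_innerFamilyCLM _).clm_comp (ContinuousMap.toLp 2 μ ℝ)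

variable [SecondCountableTopology X]

lemma isSymmetric_integralEnd (K : C(X × X, ℝ)) (hK : ∀ x y, K (x, y) = K (y, x)) :
    (integralEnd μ K : Lp ℝ 2 μ →ₗ[ℝ] Lp ℝ 2 μ).IsSymmetric := by
  have key : ∀ h g : Lp ℝ 2 μ,
      ⟪integralEnd μ K h, g⟫_ℝ = ∫ x, ∫ y, K (x, y) * (h y * g x) ∂μ ∂μ := by
    intro h g
    rw [L2.inner_def]
    refine integral_congr_ae ?_
    filter_upwards [ContinuousMap.coeFn_toLp (p := 2) (𝕜 := ℝ) μ (integralOp μ K h)] with x hx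
    have : (integralEnd μ K h : X → ℝ) x = integralOp μ K h x := hx
    rw [this, integralOp_apply]
    simp only [← mul_assoc, integral_mul_const]
    simp [mul_comm]
  intro h g
  simp only [ContinuousLinearMap.coe_coe]
  rw [real_inner_comm (integralEnd μ K g) h, key, key, integral_integral_swap]
  · refine integral_congr_ae (.of_forall fun x => integral_congr_ae (.of_forall fun y => ?_))
    simp only
    rw [hK, mul_comm (h x)]
  · have hh : Integrable h μ := (Lp.memLp h).integrable (by norm_num)
    have hg : Integrable g μ := (Lp.memLp g).integrable (by norm_num)
    have hgh : Integrable (fun p : X × X => h p.2 * g p.1) (μ.prod μ) := by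
      simpa [mul_comm] using hg.mul_prod hh
    exact hgh.bdd_mul (c := ‖K‖) K.continuous.aestronglyMeasurable
      (.of_forall fun p => K.norm_coe_le_norm p)

/-- The continuous joint eigenfunctions of two integral operators, with nonzero eigenvalue for
the first one. -/
def jointEigenfunctions (K L : C(X × X, ℝ)) : Set C(X, ℝ) :=
  {v | ∃ a c : ℝ, a ≠ 0 ∧ integralOp μ K (ContinuousMap.toLp 2 μ ℝ v) = a • v ∧
    integralOp μ L (ContinuousMap.toLp 2 μ ℝ v) = c • v}

variable {K L : C(X × X, ℝ)}

/-- The image of a nonzero eigenspace of the first operator under that operator consists of sums of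
joint eigenfunctions. -/
lemma integralOp_mem_span_of_mem_eigenspace
    (hL : ∀ x y, L (x, y) = L (y, x))
    (hKL : ∀ u : C(X, ℝ),
      integralOp μ K (integralEnd μ L (ContinuousMap.toLp 2 μ ℝ u)) =
        integralOp μ L (integralEnd μ K (ContinuousMap.toLp 2 μ ℝ u)))
    {a : ℝ} (ha : a ≠ 0) {e : Lp ℝ 2 μ}
    (he : e ∈ Module.End.eigenspace (integralEnd μ K : Lp ℝ 2 μ →ₗ[ℝ] Lp ℝ 2 μ) a) :
    integralOp μ K e ∈ Submodule.span ℝ (jointEigenfunctions μ K L) := by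
  set T : Lp ℝ 2 μ →ₗ[ℝ] Lp ℝ 2 μ := (integralEnd μ K).toLinearMap
  set S : Lp ℝ 2 μ →ₗ[ℝ] Lp ℝ 2 μ := (integralEnd μ L).toLinearMap
  set E := Module.End.eigenspace T a
  have hlift : ∀ e ∈ E, e = ContinuousMap.toLp 2 μ ℝ (a⁻¹ • integralOp μ K e) := by
    intro e he
    rw [Module.End.mem_eigenspace_iff] at he
    rw [map_smul, eq_inv_smul_iff₀ ha, ← he]
    rfl
  have hcomm : ∀ e ∈ E, integralOp μ K (S e) = integralOp μ L (T e) := by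
    intro e he
    rw [hlift e he]
    exact hKL _
  have hinv : ∀ e ∈ E, S e ∈ E := by
    intro e he
    rw [Module.End.mem_eigenspace_iff]
    calc T (S e) = ContinuousMap.toLp 2 μ ℝ (integralOp μ K (S e)) := rfl
      _ = S (T e) := by rw [hcomm e he]; rfl
      _ = a • S e := by rw [Module.End.mem_eigenspace_iff.1 he, map_smul]
  have : FiniteDimensional ℝ E :=
    ContinuousLinearMap.finite_dimensional_eigenspace (isCompactOperator_integralEnd μ K) a ha
  have hsymm : (S.restrict hinv).IsSymmetric :=
    (isSymmetric_integralEnd μ L hL).restrict_invariant hinv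
  have htop : (⟨e, he⟩ : E) ∈ ⨆ c, Module.End.eigenspace (S.restrict hinv) c := by
    rw [(Submodule.orthogonal_eq_bot_iff).1 hsymm.orthogonalComplement_iSup_eigenspaces_eq_bot]
    trivial
  refine Submodule.iSup_induction (motive := fun z : E =>
    integralOp μ K (z : Lp ℝ 2 μ) ∈ Submodule.span ℝ (jointEigenfunctions μ K L)) _ htop ?_ ?_ ?_
  · rintro c ⟨z, hz⟩ hzc
    have hSz : S z = c • z := congrArg Subtype.val (Module.End.mem_eigenspace_iff.1 hzc)
    have hTz : T z = a • z := Module.End.mem_eigenspace_iff.1 hz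
    refine Submodule.subset_span ⟨a, c, ha, ?_, ?_⟩
    · change integralOp μ K (T z) = _
      rw [hTz, map_smul]
    · change integralOp μ L (T z) = _
      rw [← hcomm z hz, hSz, map_smul]
  · simp
  · intro y z hy hz
    simpa using Submodule.add_mem _ hy hz

/-- Applying the first operator twice lands in the uniform closure of the sums of joint
eigenfunctions. -/
lemma integralOp_integralEnd_mem_closure_span (hK : ∀ x y, K (x, y) = K (y, x))
    (hL : ∀ x y, L (x, y) = L (y, x))
    (hKL : ∀ u : C(X, ℝ),
      integralOp μ K (integralEnd μ L (ContinuousMap.toLp 2 μ ℝ u)) =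
        integralOp μ L (integralEnd μ K (ContinuousMap.toLp 2 μ ℝ u)))
    (h : Lp ℝ 2 μ) :
    integralOp μ K (integralEnd μ K h) ∈
      closure (Submodule.span ℝ (jointEigenfunctions μ K L) : Set C(X, ℝ)) := by
  set T : Lp ℝ 2 μ →ₗ[ℝ] Lp ℝ 2 μ := (integralEnd μ K).toLinearMap
  set M := ⨆ a, Module.End.eigenspace T a
  have hdense : h ∈ closure (M : Set (Lp ℝ 2 μ)) := by
    have : M.topologicalClosure = ⊤ := by
      rw [Submodule.topologicalClosure_eq_top_iff]
      exact ContinuousLinearMap.orthogonalComplement_iSup_eigenspaces_eq_bot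
        (isCompactOperator_integralEnd μ K) (isSymmetric_integralEnd μ K hK)
    rw [← Submodule.topologicalClosure_coe, this]
    trivial
  refine map_mem_closure (f := fun z => integralOp μ K (T z))
    ((integralOp μ K).continuous.comp (integralEnd μ K).continuous) hdense fun z hz => ?_
  refine Submodule.iSup_induction (motive := fun z =>
    integralOp μ K (T z) ∈ Submodule.span ℝ (jointEigenfunctions μ K L)) _ hz ?_ ?_ ?_
  · intro a e he
    rw [Module.End.mem_eigenspace_iff.1 he, map_smul]
    rcases eq_or_ne a 0 with rfl | ha
    · simp
    · exact Submodule.smul_mem _ _ (integralOp_mem_span_of_mem_eigenspace μ hL hKL ha he)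
  · simp
  · intro y z hy hz
    simpa using Submodule.add_mem _ hy hz

end L2

section Laplacian

open scoped Laplacian

variable {k : ℕ}

/-- The coordinate expression of the Euclidean Laplacian. -/
noncomputable def coordLaplacian (g : EuclideanSpace ℝ (Fin k) → ℝ)
    (x : EuclideanSpace ℝ (Fin k)) : ℝ :=
  ∑ j, fderiv ℝ (fun y => fderiv ℝ g y (EuclideanSpace.single j (1 : ℝ)))
    x (EuclideanSpace.single j (1 : ℝ))

lemma coordLaplacian_eq_laplacian {g : EuclideanSpace ℝ (Fin k) → ℝ}
    (hg : ContDiff ℝ (⊤ : ℕ∞) g) : coordLaplacian g = Δ g := by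
  ext x
  rw [InnerProductSpace.laplacian_eq_iteratedFDeriv_orthonormalBasis g
    (EuclideanSpace.basisFun (Fin k) ℝ)]
  refine Finset.sum_congr rfl fun j _ => ?_
  have hd : DifferentiableAt ℝ (fderiv ℝ g) x :=
    ((hg.fderiv_right (m := 1) (by norm_cast)).differentiable one_ne_zero) x
  rw [fderiv_clm_apply hd (differentiableAt_const _), iteratedFDeriv_two_apply]
  simp

lemma laplacian_comp_linearIsometryEquiv {E : Type*} [NormedAddCommGroup E]
    [InnerProductSpace ℝ E] [FiniteDimensional ℝ E] (A : E ≃ₗᵢ[ℝ] E) (g : E → ℝ) (x : E) :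
    (Δ (g ∘ A)) x = (Δ g) (A x) := by
  set b := stdOrthonormalBasis ℝ E
  rw [InnerProductSpace.laplacian_eq_iteratedFDeriv_orthonormalBasis _ b,
    InnerProductSpace.laplacian_eq_iteratedFDeriv_orthonormalBasis _ (b.map A)]
  refine Finset.sum_congr rfl fun j _ => ?_
  have := A.toContinuousLinearEquiv.iteratedFDerivWithin_comp_right g uniqueDiffOn_univ
    (x := x) (Set.mem_univ _) 2
  simp only [Set.preimage_univ, iteratedFDerivWithin_univ] at this
  change iteratedFDeriv ℝ 2 (g ∘ A.toContinuousLinearEquiv) x _ = _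
  rw [this, ContinuousMultilinearMap.compContinuousLinearMap_apply]
  congr 1
  ext i
  fin_cases i <;> simp

lemma coordLaplacian_radial {φ : EuclideanSpace ℝ (Fin k) → ℝ} (hφ : ContDiff ℝ (⊤ : ℕ∞) φ)
    (hrad : ∀ x y, ‖x‖ = ‖y‖ → φ x = φ y) (x y : EuclideanSpace ℝ (Fin k)) (hxy : ‖x‖ = ‖y‖) :
    coordLaplacian φ x = coordLaplacian φ y := by
  set A := (ℝ ∙ (x - y))ᗮ.reflection
  have hA : A x = y := Submodule.reflection_sub hxy
  have hφA : φ ∘ A = φ := funext fun z => hrad _ _ (A.norm_map z)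
  rw [coordLaplacian_eq_laplacian hφ, ← hA, ← laplacian_comp_linearIsometryEquiv, hφA]

lemma contDiff_coordLaplacian {φ : EuclideanSpace ℝ (Fin k) → ℝ} (hφ : ContDiff ℝ (⊤ : ℕ∞) φ) :
    ContDiff ℝ (⊤ : ℕ∞) (coordLaplacian φ) := by
  refine ContDiff.sum fun j _ => ?_
  have h1 : ContDiff ℝ (⊤ : ℕ∞) fun y => fderiv ℝ φ y (EuclideanSpace.single j (1 : ℝ)) :=
    (hφ.fderiv_right (m := (⊤ : ℕ∞)) (by norm_cast)).clm_apply contDiff_const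
  exact (h1.fderiv_right (m := (⊤ : ℕ∞)) (by norm_cast)).clm_apply contDiff_const

lemma hasCompactSupport_coordLaplacian {φ : EuclideanSpace ℝ (Fin k) → ℝ}
    (hs : HasCompactSupport φ) : HasCompactSupport (coordLaplacian φ) := by
  refine hs.mono' fun x hx => ?_
  by_contra h
  refine hx (Finset.sum_eq_zero fun j _ => ?_)
  have h0 : (fun y => fderiv ℝ φ y (EuclideanSpace.single j (1 : ℝ))) =ᶠ[𝓝 x] fun _ => 0 := by
    filter_upwards [(isClosed_tsupport φ).isOpen_compl.mem_nhds h] with y hy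
    rw [show fderiv ℝ φ y = 0 from
      image_eq_zero_of_notMem_tsupport fun h' => hy (tsupport_fderiv_subset ℝ h')]
    simp
  rw [h0.fderiv_eq]
  simp

lemma fderiv_convolution_apply {u φ : EuclideanSpace ℝ (Fin k) → ℝ} (hu : Continuous u)
    (hφ : ContDiff ℝ (⊤ : ℕ∞) φ) (hs : HasCompactSupport φ) (v : EuclideanSpace ℝ (Fin k)) :
    (fun x => fderiv ℝ (u ⋆[ContinuousLinearMap.mul ℝ ℝ, volume] φ) x v) =
      (u ⋆[ContinuousLinearMap.mul ℝ ℝ, volume] fun x => fderiv ℝ φ x v) := by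
  ext x
  rw [(hs.hasFDerivAt_convolution_right (ContinuousLinearMap.mul ℝ ℝ) hu.locallyIntegrable
    (hφ.of_le (by norm_cast)) x).fderiv]
  exact convolution_precompR_apply _ hu.locallyIntegrable (hs.fderiv ℝ)
    (hφ.continuous_fderiv (by simp)) x v

lemma coordLaplacian_convolution {u φ : EuclideanSpace ℝ (Fin k) → ℝ} (hu : Continuous u)
    (hφ : ContDiff ℝ (⊤ : ℕ∞) φ) (hs : HasCompactSupport φ) :
    coordLaplacian (u ⋆[ContinuousLinearMap.mul ℝ ℝ, volume] φ) =
      (u ⋆[ContinuousLinearMap.mul ℝ ℝ, volume] coordLaplacian φ) := by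
  have hd (j : Fin k) :
      ContDiff ℝ (⊤ : ℕ∞) fun y => fderiv ℝ φ y (EuclideanSpace.single j (1 : ℝ)) :=
    (hφ.fderiv_right (m := (⊤ : ℕ∞)) (by norm_cast)).clm_apply contDiff_const
  have hds (j : Fin k) :
      HasCompactSupport fun y => fderiv ℝ φ y (EuclideanSpace.single j (1 : ℝ)) :=
    hs.fderiv_apply ℝ _
  have hdd (j : Fin k) : Continuous fun x => fderiv ℝ
      (fun y => fderiv ℝ φ y (EuclideanSpace.single j (1 : ℝ))) x
        (EuclideanSpace.single j (1 : ℝ)) :=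
    ((hd j).continuous_fderiv (by simp)).clm_apply continuous_const
  ext x
  unfold coordLaplacian
  simp only [fderiv_convolution_apply hu hφ hs]
  have (j : Fin k) := congrFun (fderiv_convolution_apply hu (hd j) (hds j)
    (EuclideanSpace.single j (1 : ℝ))) x
  simp only [this]
  simp only [convolution_def, ContinuousLinearMap.mul_apply', Finset.mul_sum]
  rw [integral_finsetSum]
  intro j _
  exact ((hds j).fderiv_apply ℝ _).convolutionExists_right (ContinuousLinearMap.mul ℝ ℝ)
    hu.locallyIntegrable (hdd j) x

end Laplacian

section Periodization

variable {V : Type*} [NormedAddCommGroup V]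

/-- Proper discontinuity of a group of isometries. -/
def ActsProperlyDiscontinuously (Λ : Subgroup (V ≃ᵢ V)) : Prop :=
  ∀ K : Set V, IsCompact K → {g : V ≃ᵢ V | g ∈ Λ ∧ ((g '' K) ∩ K).Nonempty}.Finite

lemma ActsProperlyDiscontinuously.finite_setOf {Λ : Subgroup (V ≃ᵢ V)}
    (h : ActsProperlyDiscontinuously Λ) {K : Set V} (hK : IsCompact K) :
    {γ : Λ | ∃ x ∈ K, (γ : V ≃ᵢ V) x ∈ K}.Finite := by
  refine Set.Finite.of_finite_image ((h K hK).subset ?_) Subtype.val_injective.injOn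
  rintro _ ⟨γ, ⟨x, hx, hγx⟩, rfl⟩
  exact ⟨γ.2, _, ⟨x, hx, rfl⟩, hγx⟩

/-- The sum of the convolution kernel `φ (x - y)` over the orbit of `x`. -/
noncomputable def periodization (Λ : Subgroup (V ≃ᵢ V)) (φ : V → ℝ) (p : V × V) : ℝ :=
  ∑ᶠ γ : Λ, φ ((γ : V ≃ᵢ V) p.1 - p.2)

variable {Λ : Subgroup (V ≃ᵢ V)} {φ : V → ℝ}

lemma locallyFinite_support_periodization [ProperSpace V] (h : ActsProperlyDiscontinuously Λ)
    (hs : HasCompactSupport φ) :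
    LocallyFinite fun γ : Λ =>
      Function.support fun p : V × V => φ ((γ : V ≃ᵢ V) p.1 - p.2) := by
  intro p
  obtain ⟨R, hR, hφR⟩ := hs.exists_pos_le_norm
  refine ⟨_, Metric.ball_mem_nhds p one_pos,
    (h.finite_setOf (isCompact_closedBall (0 : V) (‖p‖ + 1 + R))).subset ?_⟩
  rintro γ ⟨q, hq, hqp⟩
  have hqn : ‖q‖ ≤ ‖p‖ + 1 := by
    have := norm_le_norm_add_norm_sub p q
    rw [Metric.mem_ball, dist_eq_norm] at hqp
    linarith [norm_sub_rev p q]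
  have hsub : ‖(γ : V ≃ᵢ V) q.1 - q.2‖ < R := by
    by_contra! hle
    exact hq (hφR _ hle)
  have h1 : ‖q.1‖ ≤ ‖q‖ := norm_fst_le q
  have h2 : ‖q.2‖ ≤ ‖q‖ := norm_snd_le q
  refine ⟨q.1, ?_, ?_⟩ <;> rw [mem_closedBall_zero_iff]
  · linarith
  · have := norm_le_norm_add_norm_sub q.2 ((γ : V ≃ᵢ V) q.1)
    rw [norm_sub_rev] at this
    linarith [norm_sub_rev q.2 ((γ : V ≃ᵢ V) q.1)]

lemma continuous_periodization [ProperSpace V] (h : ActsProperlyDiscontinuously Λ)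
    (hc : Continuous φ) (hs : HasCompactSupport φ) : Continuous (periodization Λ φ) :=
  continuous_finsum (fun γ => hc.comp
    (((γ : V ≃ᵢ V).continuous.comp continuous_fst).sub continuous_snd))
    (locallyFinite_support_periodization h hs)

lemma finite_support_periodization [ProperSpace V] (h : ActsProperlyDiscontinuously Λ)
    (hs : HasCompactSupport φ) (p : V × V) :
    (Function.support fun γ : Λ => φ ((γ : V ≃ᵢ V) p.1 - p.2)).Finite :=
  (locallyFinite_support_periodization h hs).point_finite p

lemma periodization_smul_left {γ : V ≃ᵢ V} (hγ : γ ∈ Λ) (x y : V) :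
    periodization Λ φ (γ x, y) = periodization Λ φ (x, y) :=
  finsum_comp_equiv (Equiv.mulRight (⟨γ, hγ⟩ : Λ)) (f := fun δ : Λ => φ ((δ : V ≃ᵢ V) x - y))

lemma periodization_comm (hrad : ∀ x y, ‖x‖ = ‖y‖ → φ x = φ y) (x y : V) :
    periodization Λ φ (x, y) = periodization Λ φ (y, x) := by
  unfold periodization
  rw [← finsum_comp_equiv (Equiv.inv Λ)]
  refine finsum_congr fun γ => hrad _ _ ?_
  have := (γ : V ≃ᵢ V).dist_eq ((γ : V ≃ᵢ V)⁻¹ x) y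
  rw [← IsometryEquiv.mul_apply, mul_inv_cancel, IsometryEquiv.coe_one, id] at this
  rw [← dist_eq_norm, ← dist_eq_norm, dist_comm _ x, this]
  rfl

end Periodization

section RadialCutoff

variable {V : Type*} [NormedAddCommGroup V]

/-- A radial smooth function, positive exactly on the ball of radius `r` around the origin. -/
noncomputable def radialCutoff (r : ℝ) (x : V) : ℝ := Real.smoothTransition (r ^ 2 - ‖x‖ ^ 2)

lemma contDiff_radialCutoff [InnerProductSpace ℝ V] (r : ℝ) :
    ContDiff ℝ (⊤ : ℕ∞) (radialCutoff r : V → ℝ) :=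
  Real.smoothTransition.contDiff.comp (contDiff_const.sub (contDiff_norm_sq ℝ))

lemma radialCutoff_nonneg (r : ℝ) (x : V) : 0 ≤ radialCutoff r x :=
  Real.smoothTransition.nonneg _

lemma radialCutoff_pos {r : ℝ} {x : V} (hx : ‖x‖ < r) : 0 < radialCutoff r x :=
  Real.smoothTransition.pos_of_pos (by nlinarith [norm_nonneg x])

lemma radialCutoff_eq_zero {r : ℝ} (hr : 0 ≤ r) {x : V} (hx : r ≤ ‖x‖) : radialCutoff r x = 0 :=
  Real.smoothTransition.zero_of_nonpos (by nlinarith)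

lemma support_radialCutoff_subset {r : ℝ} (hr : 0 ≤ r) :
    Function.support (radialCutoff r : V → ℝ) ⊆ Metric.ball 0 r := by
  intro x hx
  rw [mem_ball_zero_iff]
  by_contra! h
  exact hx (radialCutoff_eq_zero hr h)

lemma hasCompactSupport_radialCutoff [ProperSpace V] {r : ℝ} (hr : 0 ≤ r) :
    HasCompactSupport (radialCutoff r : V → ℝ) :=
  HasCompactSupport.intro (isCompact_closedBall 0 r) fun x hx =>
    radialCutoff_eq_zero hr (by rw [mem_closedBall_zero_iff] at hx; linarith)

lemma radialCutoff_radial (r : ℝ) (x y : V) (h : ‖x‖ = ‖y‖) :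
    radialCutoff r x = radialCutoff r y := by
  rw [radialCutoff, radialCutoff, h]

end RadialCutoff

section Weight

variable {V : Type*} [NormedAddCommGroup V] [InnerProductSpace ℝ V] {Λ : Subgroup (V ≃ᵢ V)}

/-- A continuous replacement for the indicator function of a fundamental domain. -/
lemma exists_periodic_partition [ProperSpace V] (h : ActsProperlyDiscontinuously Λ)
    (hcocpt : ∃ K : Set V, IsCompact K ∧ (⋃ g ∈ Λ, (g : V ≃ᵢ V) '' K) = Set.univ) :
    ∃ w : V → ℝ, Continuous w ∧ HasCompactSupport w ∧ (∀ x, 0 ≤ w x) ∧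
      ∀ x, ∑ᶠ γ : Λ, w ((γ : V ≃ᵢ V) x) = 1 := by
  obtain ⟨K, hK, hKΛ⟩ := hcocpt
  obtain ⟨R, hR, hKR⟩ := hK.isBounded.subset_ball_lt 0 (0 : V)
  set η : V → ℝ := radialCutoff R
  have hηc : Continuous η := (contDiff_radialCutoff R).continuous
  have hηs : HasCompactSupport η := hasCompactSupport_radialCutoff hR.le
  set P : V → ℝ := fun x => periodization Λ η (x, 0)
  have hPc : Continuous P :=
    (continuous_periodization h hηc hηs).comp (by fun_prop)
  have hPpos : ∀ x, 0 < P x := by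
    intro x
    have hx : x ∈ ⋃ g ∈ Λ, (g : V ≃ᵢ V) '' K := hKΛ ▸ Set.mem_univ x
    simp only [Set.mem_iUnion] at hx
    obtain ⟨g, hg, y, hy, rfl⟩ := hx
    change 0 < periodization Λ η (g y, 0)
    rw [periodization_smul_left hg]
    refine finsum_pos (fun γ => radialCutoff_nonneg _ _) ⟨1, ?_⟩
      (finite_support_periodization h hηs (y, 0))
    exact radialCutoff_pos (by simpa using hKR hy)
  refine ⟨fun x => η x * (P x)⁻¹, hηc.mul (hPc.inv₀ fun x => (hPpos x).ne'),
    hηs.mul_right, fun x => mul_nonneg (radialCutoff_nonneg _ _) (inv_nonneg.2 (hPpos x).le),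
    fun x => ?_⟩
  have hPinv (γ : Λ) : P ((γ : V ≃ᵢ V) x) = P x := periodization_smul_left γ.2 x 0
  simp only [hPinv]
  rw [← finsum_mul]
  have : ∑ᶠ γ : Λ, η ((γ : V ≃ᵢ V) x) = P x := by simp [P, periodization]
  rw [this, mul_inv_cancel₀ (hPpos x).ne']

variable [FiniteDimensional ℝ V] [MeasurableSpace V] [BorelSpace V]

lemma IsometryEquiv.measurePreserving_volume (γ : V ≃ᵢ V) :
    MeasurePreserving γ (volume : Measure V) volume := by
  rw [← InnerProductSpace.euclideanHausdorffMeasure_eq_volume]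
  exact γ.measurePreserving_euclideanHausdorffMeasure _

/-- Unfolding: convolution of an invariant function against a radial kernel is an integral of the
periodized kernel against the weight `w`. -/
lemma integral_mul_eq_integral_periodization (h : ActsProperlyDiscontinuously Λ)
    {w : V → ℝ} (hwc : Continuous w) (hws : HasCompactSupport w)
    (hw : ∀ x, ∑ᶠ γ : Λ, w ((γ : V ≃ᵢ V) x) = 1) {φ : V → ℝ} (hφ : Continuous φ)
    (hs : HasCompactSupport φ) (hrad : ∀ x y, ‖x‖ = ‖y‖ → φ x = φ y)
    {u : V → ℝ} (hu : Continuous u) (hinv : ∀ γ ∈ Λ, ∀ x, u (γ x) = u x) (x : V) :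
    ∫ y, φ (x - y) * u y = ∫ y, w y * (periodization Λ φ (x, y) * u y) := by
  obtain ⟨R, hR, hφR⟩ := hs.exists_pos_le_norm
  obtain ⟨r, hr, hwr⟩ := hws.exists_pos_le_norm
  have hfin := h.finite_setOf (isCompact_closedBall (0 : V) (‖x‖ + R + r))
  set S : Finset Λ := hfin.toFinset
  have hS {γ : Λ} {y : V} (h1 : ‖y‖ ≤ ‖x‖ + R + r) (h2 : ‖(γ : V ≃ᵢ V) y‖ ≤ ‖x‖ + R + r) :
      γ ∈ S := by
    rw [Set.Finite.mem_toFinset]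
    exact ⟨y, by simpa using h1, by simpa using h2⟩
  have hφx {y : V} (hy : φ (x - y) ≠ 0) : ‖y‖ ≤ ‖x‖ + R + r := by
    have h1 : ‖x - y‖ < R := by
      by_contra! hle
      exact hy (hφR _ hle)
    have h2 := norm_le_norm_add_norm_sub x y
    rw [norm_sub_rev] at h1
    linarith [norm_sub_rev x y]
  have hwx {y : V} (hy : w y ≠ 0) : ‖y‖ ≤ ‖x‖ + R + r := by
    have h1 : ‖y‖ < r := by
      by_contra! hle
      exact hy (hwr _ hle)
    linarith [norm_nonneg x]
  have hint (γ : Λ) : Integrable fun y => w ((γ : V ≃ᵢ V) y) * (φ (x - y) * u y) := by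
    refine Continuous.integrable_of_hasCompactSupport (by
      have := (γ : V ≃ᵢ V).continuous
      fun_prop) ?_
    exact ((hs.comp_homeomorph (Homeomorph.subLeft x)).mul_right).mul_left
  calc ∫ y, φ (x - y) * u y = ∫ y, ∑ γ ∈ S, w ((γ : V ≃ᵢ V) y) * (φ (x - y) * u y) := by
        congr 1 with y
        rw [← Finset.sum_mul]
        by_cases hy : φ (x - y) = 0
        · simp [hy]
        · rw [← finsum_eq_sum_of_support_subset, hw, one_mul]
          exact fun γ hγ => hS (hφx hy) (hwx hγ)
    _ = ∑ γ ∈ S, ∫ y, w ((γ : V ≃ᵢ V) y) * (φ (x - y) * u y) :=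
        integral_finsetSum _ fun γ _ => hint γ
    _ = ∑ γ ∈ S, ∫ y, w y * (φ ((γ : V ≃ᵢ V) x - y) * u y) := by
        refine Finset.sum_congr rfl fun γ _ => ?_
        refine Eq.trans ?_ ((IsometryEquiv.measurePreserving_volume (γ : V ≃ᵢ V)).integral_comp
          (γ : V ≃ᵢ V).toHomeomorph.measurableEmbedding
          fun y => w y * (φ ((γ : V ≃ᵢ V) x - y) * u y))
        congr 1 with y
        rw [hinv _ γ.2, hrad (x - y) ((γ : V ≃ᵢ V) x - (γ : V ≃ᵢ V) y)]
        rw [← dist_eq_norm, ← dist_eq_norm, IsometryEquiv.dist_eq]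
    _ = ∫ y, ∑ γ ∈ S, w y * (φ ((γ : V ≃ᵢ V) x - y) * u y) := by
        refine (integral_finsetSum _ fun γ _ => ?_).symm
        refine Continuous.integrable_of_hasCompactSupport (by fun_prop) hws.mul_right
    _ = ∫ y, w y * (periodization Λ φ (x, y) * u y) := by
        congr 1 with y
        rw [← Finset.mul_sum, ← Finset.sum_mul]
        by_cases hy : w y = 0
        · simp [hy]
        · rw [periodization, finsum_eq_sum_of_support_subset]
          intro γ hγ
          have hγ' : φ (x - (γ : V ≃ᵢ V)⁻¹ y) ≠ 0 := by
            suffices φ (x - (γ : V ≃ᵢ V)⁻¹ y) = φ ((γ : V ≃ᵢ V) x - y) from this ▸ hγ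
            refine hrad _ _ ?_
            have := (γ : V ≃ᵢ V).dist_eq x ((γ : V ≃ᵢ V)⁻¹ y)
            rw [← IsometryEquiv.mul_apply, mul_inv_cancel, IsometryEquiv.coe_one, id] at this
            rw [← dist_eq_norm, ← dist_eq_norm, this]
          refine hS (hφx hγ') ?_
          rw [← IsometryEquiv.mul_apply, mul_inv_cancel, IsometryEquiv.coe_one, id]
          exact hwx hy

end Weight

section Convolution

variable {V : Type*} [NormedAddCommGroup V] [InnerProductSpace ℝ V] [FiniteDimensional ℝ V]
  [MeasurableSpace V] [BorelSpace V] {u φ ψ : V → ℝ}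

lemma continuous_convolution_of_hasCompactSupport (hu : Continuous u) (hφ : Continuous φ)
    (hs : HasCompactSupport φ) : Continuous (u ⋆[ContinuousLinearMap.mul ℝ ℝ, volume] φ) :=
  hs.continuous_convolution_right _ hu.locallyIntegrable hφ

lemma convolution_mul_comm (u φ : V → ℝ) :
    u ⋆[ContinuousLinearMap.mul ℝ ℝ, volume] φ = φ ⋆[ContinuousLinearMap.mul ℝ ℝ, volume] u := by
  rw [← convolution_flip]
  congr 1
  ext
  simp

lemma convolution_mul_right_comm (hu : Continuous u) (hφ : Continuous φ)
    (hφs : HasCompactSupport φ) (hψ : Continuous ψ) (hψs : HasCompactSupport ψ) :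
    (u ⋆[ContinuousLinearMap.mul ℝ ℝ, volume] φ) ⋆[ContinuousLinearMap.mul ℝ ℝ, volume] ψ =
      (u ⋆[ContinuousLinearMap.mul ℝ ℝ, volume] ψ) ⋆[ContinuousLinearMap.mul ℝ ℝ, volume] φ := by
  have assoc {φ ψ : V → ℝ} (hφ : Continuous φ) (hφs : HasCompactSupport φ) (hψ : Continuous ψ)
      (hψs : HasCompactSupport ψ) :
      (u ⋆[ContinuousLinearMap.mul ℝ ℝ, volume] φ) ⋆[ContinuousLinearMap.mul ℝ ℝ, volume] ψ =
      u ⋆[ContinuousLinearMap.mul ℝ ℝ, volume] (φ ⋆[ContinuousLinearMap.mul ℝ ℝ, volume] ψ) := by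
    ext x
    refine convolution_assoc _ _ _ _ (fun a b c => by simp [mul_assoc]) hu.aestronglyMeasurable
      hφ.aestronglyMeasurable hψ.aestronglyMeasurable ?_ ?_ ?_
    · exact .of_forall (hφs.convolutionExists_right _ hu.locallyIntegrable hφ)
    · exact .of_forall (hψs.norm.convolutionExists_right _ hφ.norm.locallyIntegrable hψ.norm)
    · exact (hφs.norm.convolution _ hψs.norm).convolutionExists_right _
        hu.norm.locallyIntegrable
        (continuous_convolution_of_hasCompactSupport hφ.norm hψ.norm hψs.norm) x
  rw [assoc hφ hφs hψ hψs, assoc hψ hψs hφ hφs, convolution_mul_comm φ]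

lemma dist_convolution_mul_le {r ε : ℝ} (hε : 0 ≤ ε) (hsupp : Function.support φ ⊆ Metric.ball 0 r)
    (hφ : ∀ x, 0 ≤ φ x) (hint : ∫ x, φ x = 1) (hu : Continuous u) {x : V} {z : ℝ}
    (h : ∀ y ∈ Metric.ball x r, dist (u y) z ≤ ε) :
    dist ((u ⋆[ContinuousLinearMap.mul ℝ ℝ, volume] φ) x) z ≤ ε := by
  rw [convolution_mul_comm]
  exact dist_convolution_le hε hsupp hφ hint hu.aestronglyMeasurable h

end Convolution

section OrbitSpace

variable {V : Type*} [NormedAddCommGroup V] {Λ : Subgroup (V ≃ᵢ V)}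

/-- The equivalence relation whose classes are the orbits of a group of isometries. -/
def orbitSetoid (Λ : Subgroup (V ≃ᵢ V)) : Setoid V where
  r x y := ∃ γ ∈ Λ, γ x = y
  iseqv :=
    { refl := fun x => ⟨1, one_mem _, rfl⟩
      symm := by
        rintro x _ ⟨γ, hγ, rfl⟩
        exact ⟨γ⁻¹, inv_mem hγ, γ.symm_apply_apply x⟩
      trans := by
        rintro x _ _ ⟨γ, hγ, rfl⟩ ⟨δ, hδ, rfl⟩
        exact ⟨δ * γ, mul_mem hδ hγ, rfl⟩ }

variable (Λ) in
lemma isOpenQuotientMap_orbitSetoid :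
    IsOpenQuotientMap (Quotient.mk (orbitSetoid Λ)) := by
  refine ⟨Quotient.mk_surjective, continuous_quotient_mk', fun U hU => ?_⟩
  have : Quotient.mk (orbitSetoid Λ) ⁻¹' (Quotient.mk (orbitSetoid Λ) '' U) =
      ⋃ γ : Λ, (γ : V ≃ᵢ V) '' U := by
    ext y
    simp only [Set.mem_preimage, Set.mem_image, Set.mem_iUnion]
    constructor
    · rintro ⟨x, hx, hxy⟩
      obtain ⟨γ, hγ, rfl⟩ := Quotient.exact hxy
      exact ⟨⟨γ, hγ⟩, x, hx, rfl⟩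
    · rintro ⟨γ, x, hx, rfl⟩
      exact ⟨x, hx, Quotient.sound ⟨γ, γ.2, rfl⟩⟩
  rw [← isQuotientMap_quotient_mk'.isOpen_preimage]
  change IsOpen (Quotient.mk (orbitSetoid Λ) ⁻¹' _)
  rw [this]
  exact isOpen_iUnion fun γ => (γ : V ≃ᵢ V).toHomeomorph.isOpenMap U hU

lemma compactSpace_quotient_orbitSetoid
    (hcocpt : ∃ K : Set V, IsCompact K ∧ (⋃ g ∈ Λ, (g : V ≃ᵢ V) '' K) = Set.univ) :
    CompactSpace (Quotient (orbitSetoid Λ)) := by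
  obtain ⟨K, hK, hKΛ⟩ := hcocpt
  refine ⟨?_⟩
  convert hK.image (continuous_quotient_mk' (s := orbitSetoid Λ))
  refine (Set.eq_univ_of_forall fun p => ?_).symm
  obtain ⟨x, rfl⟩ := Quotient.mk_surjective p
  have hx : x ∈ ⋃ g ∈ Λ, (g : V ≃ᵢ V) '' K := hKΛ ▸ Set.mem_univ x
  simp only [Set.mem_iUnion] at hx
  obtain ⟨g, hg, y, hy, rfl⟩ := hx
  exact ⟨y, hy, Quotient.sound ⟨g, hg, rfl⟩⟩

lemma exists_lift_orbitSetoid {u : V → ℝ} (hu : Continuous u) (hinv : ∀ γ ∈ Λ, ∀ x, u (γ x) = u x) :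
    ∃ v : C(Quotient (orbitSetoid Λ), ℝ), ∀ x, v (Quotient.mk _ x) = u x :=
  ⟨⟨Quotient.lift u (by rintro x _ ⟨γ, hγ, rfl⟩; exact (hinv γ hγ x).symm),
    hu.quotient_lift _⟩, fun _ => rfl⟩

lemma exists_lift_periodization [ProperSpace V] (h : ActsProperlyDiscontinuously Λ) {φ : V → ℝ}
    (hφ : Continuous φ) (hs : HasCompactSupport φ) (hrad : ∀ x y, ‖x‖ = ‖y‖ → φ x = φ y) :
    ∃ K : C(Quotient (orbitSetoid Λ) × Quotient (orbitSetoid Λ), ℝ),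
      (∀ x y, K (Quotient.mk _ x, Quotient.mk _ y) = periodization Λ φ (x, y)) ∧
      ∀ p q, K (p, q) = K (q, p) := by
  have hq := (isOpenQuotientMap_orbitSetoid Λ).prodMap (isOpenQuotientMap_orbitSetoid Λ)
  let F : Quotient (orbitSetoid Λ) → Quotient (orbitSetoid Λ) → ℝ :=
    Quotient.lift₂ (fun x y => periodization Λ φ (x, y)) (by
      rintro x y _ _ ⟨γ, hγ, rfl⟩ ⟨δ, hδ, rfl⟩
      rw [periodization_smul_left hγ, periodization_comm hrad x (δ y), periodization_smul_left hδ,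
        periodization_comm hrad])
  refine ⟨⟨fun p => F p.1 p.2, ?_⟩, fun _ _ => rfl, ?_⟩
  · rw [← hq.continuous_comp_iff]
    exact continuous_periodization h hφ hs
  · intro p q
    induction p using Quotient.inductionOn with | _ x
    induction q using Quotient.inductionOn with | _ y
    exact periodization_comm hrad x y

/-- An invariant continuous function is uniformly continuous when the action is cocompact. -/
lemma exists_pos_dist_lt_of_invariant
    (hcocpt : ∃ K : Set V, IsCompact K ∧ (⋃ g ∈ Λ, (g : V ≃ᵢ V) '' K) = Set.univ)
    {u : V → ℝ} (hu : Continuous u) (hinv : ∀ γ ∈ Λ, ∀ x, u (γ x) = u x) {ε : ℝ} (hε : 0 < ε) :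
    ∃ δ > 0, ∀ x y, dist x y < δ → dist (u x) (u y) < ε := by
  obtain ⟨K, hK, hKΛ⟩ := hcocpt
  obtain ⟨δ, hδ, hKδ⟩ := Metric.mem_uniformity_dist.1
    (hK.uniformContinuousAt_of_continuousAt u (fun x _ => hu.continuousAt)
      (Metric.dist_mem_uniformity hε))
  refine ⟨δ, hδ, fun x y hxy => ?_⟩
  have hx : x ∈ ⋃ g ∈ Λ, (g : V ≃ᵢ V) '' K := hKΛ ▸ Set.mem_univ x
  simp only [Set.mem_iUnion] at hx
  obtain ⟨g, hg, z, hz, rfl⟩ := hx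
  obtain ⟨y, rfl⟩ := g.surjective y
  rw [hinv g hg, hinv g hg]
  rw [g.dist_eq] at hxy
  exact hKδ hxy hz

end OrbitSpace

section LiftedOperator

variable {V : Type*} [NormedAddCommGroup V] [InnerProductSpace ℝ V] [FiniteDimensional ℝ V]
  [MeasurableSpace V] [BorelSpace V] {Λ : Subgroup (V ≃ᵢ V)}

lemma exists_measure_quotient_orbitSetoid [MeasurableSpace (Quotient (orbitSetoid Λ))]
    [BorelSpace (Quotient (orbitSetoid Λ))]
    {w : V → ℝ} (hwc : Continuous w) (hws : HasCompactSupport w) (hw0 : ∀ x, 0 ≤ w x) :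
    ∃ μ : Measure (Quotient (orbitSetoid Λ)), IsFiniteMeasure μ ∧
      ∀ F : C(Quotient (orbitSetoid Λ), ℝ), ∫ p, F p ∂μ = ∫ y, w y * F (Quotient.mk _ y) := by
  have hπ : Measurable (Quotient.mk (orbitSetoid Λ)) :=
    (isOpenQuotientMap_orbitSetoid Λ).continuous.measurable
  have := isFiniteMeasure_withDensity_ofReal
    (hwc.integrable_of_hasCompactSupport (μ := volume) hws).hasFiniteIntegral
  refine ⟨(volume.withDensity fun x => ENNReal.ofReal (w x)).map (Quotient.mk _), inferInstance,
    fun F => ?_⟩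
  rw [integral_map hπ.aemeasurable F.continuous.measurable.aestronglyMeasurable,
    integral_withDensity_eq_integral_toReal_smul (by fun_prop) (by simp)]
  simp only [ENNReal.toReal_ofReal (hw0 _), smul_eq_mul]

lemma integralOp_comp_mk [CompactSpace (Quotient (orbitSetoid Λ))]
    [MeasurableSpace (Quotient (orbitSetoid Λ))] [BorelSpace (Quotient (orbitSetoid Λ))]
    (h : ActsProperlyDiscontinuously Λ)
    {w : V → ℝ} (hwc : Continuous w) (hws : HasCompactSupport w)
    (hw : ∀ x, ∑ᶠ γ : Λ, w ((γ : V ≃ᵢ V) x) = 1)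
    {μ : Measure (Quotient (orbitSetoid Λ))} [IsFiniteMeasure μ]
    (hμ : ∀ F : C(Quotient (orbitSetoid Λ), ℝ), ∫ p, F p ∂μ = ∫ y, w y * F (Quotient.mk _ y))
    {φ : V → ℝ} (hφ : Continuous φ) (hs : HasCompactSupport φ)
    (hrad : ∀ x y, ‖x‖ = ‖y‖ → φ x = φ y)
    {K : C(Quotient (orbitSetoid Λ) × Quotient (orbitSetoid Λ), ℝ)}
    (hK : ∀ x y, K (Quotient.mk _ x, Quotient.mk _ y) = periodization Λ φ (x, y))
    (v : C(Quotient (orbitSetoid Λ), ℝ)) :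
    integralOp μ K (ContinuousMap.toLp 2 μ ℝ v) ∘ Quotient.mk _ =
      (v ∘ Quotient.mk _) ⋆[ContinuousLinearMap.mul ℝ ℝ, volume] φ := by
  have hπ := (isOpenQuotientMap_orbitSetoid Λ).continuous
  ext x
  rw [Function.comp_apply, integralOp_toLp_apply]
  refine (hμ ⟨fun p => K (Quotient.mk _ x, p) * v p, by fun_prop⟩).trans ?_
  simp only [ContinuousMap.coe_mk, hK]
  refine (integral_mul_eq_integral_periodization h hwc hws hw hφ hs hrad
    (u := v ∘ Quotient.mk _) (v.continuous.comp hπ) (fun γ hγ x => ?_) x).symm.trans ?_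
  · exact congrArg v (Quotient.sound ⟨γ⁻¹, inv_mem hγ, γ.symm_apply_apply x⟩)
  · rw [convolution_def]
    congr 1 with y
    simp [mul_comm]

end LiftedOperator

section Eigenfunctions

lemma exists_radial_bump {V : Type*} [NormedAddCommGroup V] [InnerProductSpace ℝ V]
    [FiniteDimensional ℝ V] [MeasurableSpace V] [BorelSpace V] {r : ℝ} (hr : 0 < r) :
    ∃ φ : V → ℝ, ContDiff ℝ (⊤ : ℕ∞) φ ∧ HasCompactSupport φ ∧
      (∀ x y, ‖x‖ = ‖y‖ → φ x = φ y) ∧ (∀ x, 0 ≤ φ x) ∧ ∫ x, φ x = 1 ∧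
      Function.support φ ⊆ Metric.ball 0 r := by
  have hc : Continuous (radialCutoff r : V → ℝ) := (contDiff_radialCutoff r).continuous
  have hs : HasCompactSupport (radialCutoff r : V → ℝ) := hasCompactSupport_radialCutoff hr.le
  have hpos : 0 < ∫ x : V, radialCutoff r x :=
    hc.integral_pos_of_hasCompactSupport_nonneg_nonzero hs (radialCutoff_nonneg r)
      (radialCutoff_pos (x := 0) (by simpa using hr)).ne'
  refine ⟨fun x => (∫ x : V, radialCutoff r x)⁻¹ * radialCutoff r x,
    contDiff_const.mul (contDiff_radialCutoff r), hs.mul_left, fun x y hxy => ?_,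
    fun x => mul_nonneg (inv_nonneg.2 hpos.le) (radialCutoff_nonneg r x), ?_, ?_⟩
  · simp only [radialCutoff_radial r x y hxy]
  · rw [integral_const_mul, inv_mul_cancel₀ hpos.ne']
  · exact (Function.support_mul_subset_right _ _).trans (support_radialCutoff_subset hr.le)

variable {k : ℕ}

lemma coordLaplacian_const_smul (a : ℝ) {g : EuclideanSpace ℝ (Fin k) → ℝ}
    (hg : ContDiff ℝ (⊤ : ℕ∞) g) : coordLaplacian (a • g) = a • coordLaplacian g := by
  ext x
  have hd : Differentiable ℝ g := hg.differentiable (by simp)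
  have hdd (j : Fin k) :
      Differentiable ℝ fun y => fderiv ℝ g y (EuclideanSpace.single j (1 : ℝ)) :=
    ((hg.fderiv_right (m := (⊤ : ℕ∞)) le_rfl).clm_apply contDiff_const).differentiable (by simp)
  simp only [coordLaplacian, Pi.smul_apply, Finset.smul_sum]
  refine Finset.sum_congr rfl fun j _ => ?_
  have : (fun y => fderiv ℝ (a • g) y (EuclideanSpace.single j (1 : ℝ))) =
      a • fun y => fderiv ℝ g y (EuclideanSpace.single j (1 : ℝ)) := by
    ext y
    rw [fderiv_const_smul hd.differentiableAt]
    rfl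
  rw [this, fderiv_const_smul (hdd j).differentiableAt]
  rfl

/-- A common eigenfunction of convolution with `φ` and with the Laplacian of `φ` is a smooth
eigenfunction of the Laplacian. -/
lemma coordLaplacian_eq_smul_of_convolution_eq {u φ : EuclideanSpace ℝ (Fin k) → ℝ}
    (hu : Continuous u) (hφ : ContDiff ℝ (⊤ : ℕ∞) φ) (hs : HasCompactSupport φ) {a c : ℝ}
    (ha : a ≠ 0) (h₁ : u ⋆[ContinuousLinearMap.mul ℝ ℝ, volume] φ = a • u)
    (h₂ : u ⋆[ContinuousLinearMap.mul ℝ ℝ, volume] (coordLaplacian φ) = c • u) :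
    ContDiff ℝ (⊤ : ℕ∞) u ∧ coordLaplacian u = (a⁻¹ * c) • u := by
  have hsmooth : ContDiff ℝ (⊤ : ℕ∞) (u ⋆[ContinuousLinearMap.mul ℝ ℝ, volume] φ) :=
    hs.contDiff_convolution_right _ hu.locallyIntegrable hφ
  have hu' : u = a⁻¹ • (u ⋆[ContinuousLinearMap.mul ℝ ℝ, volume] φ) := by
    rw [h₁, inv_smul_smul₀ ha]
  refine ⟨hu' ▸ contDiff_const.smul hsmooth, ?_⟩
  conv_lhs => rw [hu']
  rw [coordLaplacian_const_smul _ hsmooth, coordLaplacian_convolution hu hφ hs, h₂, mul_smul]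

end Eigenfunctions

/-- Lemma 7.4: for a discrete cocompact group `Λ` of isometries of `ℝ^k`, the finite sums
of eigenfunctions of the Euclidean Laplacian that are `Λ`-invariant are dense (in sup norm)
in the `Λ`-invariant smooth functions. -/
theorem stmt_9 (k : ℕ) (hk : 1 ≤ k)
    (Λ : Subgroup (EuclideanSpace ℝ (Fin k) ≃ᵢ EuclideanSpace ℝ (Fin k)))
    (hdisc : ∀ K : Set (EuclideanSpace ℝ (Fin k)), IsCompact K →
      {g : EuclideanSpace ℝ (Fin k) ≃ᵢ EuclideanSpace ℝ (Fin k) |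
        g ∈ Λ ∧ ((g '' K) ∩ K).Nonempty}.Finite)
    (hcocpt : ∃ K : Set (EuclideanSpace ℝ (Fin k)), IsCompact K ∧
      (⋃ g ∈ Λ, (g : EuclideanSpace ℝ (Fin k) ≃ᵢ EuclideanSpace ℝ (Fin k)) '' K) = Set.univ)
    (f : EuclideanSpace ℝ (Fin k) → ℝ) (hf : ContDiff ℝ (⊤ : ℕ∞) f)
    (hfinv : ∀ γ : EuclideanSpace ℝ (Fin k) ≃ᵢ EuclideanSpace ℝ (Fin k), γ ∈ Λ →
      ∀ x, f (γ x) = f x)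
    (ε : ℝ) (hε : 0 < ε) :
    ∃ (m : ℕ) (g : Fin m → EuclideanSpace ℝ (Fin k) → ℝ) (c : Fin m → ℝ),
      (∀ i, ContDiff ℝ (⊤ : ℕ∞) (g i)) ∧
      (∀ i, ∀ x, (∑ j, fderiv ℝ (fun y => fderiv ℝ (g i) y (EuclideanSpace.single j (1 : ℝ)))
          x (EuclideanSpace.single j (1 : ℝ))) = c i * g i x) ∧
      (∀ γ : EuclideanSpace ℝ (Fin k) ≃ᵢ EuclideanSpace ℝ (Fin k), γ ∈ Λ →
        ∀ x, (∑ i, g i (γ x)) = ∑ i, g i x) ∧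
      (∀ x, |f x - ∑ i, g i x| ≤ ε) := by
  obtain ⟨w, hwc, hws, hw0, hw⟩ := exists_periodic_partition hdisc hcocpt
  obtain ⟨δ, hδ, hfδ⟩ := exists_pos_dist_lt_of_invariant hcocpt hf.continuous hfinv
    (div_pos hε three_pos)
  obtain ⟨φ, hφ, hφs, hφrad, hφ0, hφint, hφδ⟩ :=
    exists_radial_bump (V := EuclideanSpace ℝ (Fin k)) hδ
  have hψc : Continuous (coordLaplacian φ) := (contDiff_coordLaplacian hφ).continuous
  have hψs := hasCompactSupport_coordLaplacian hφs
  have hψrad := coordLaplacian_radial hφ hφrad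
  have hq := isOpenQuotientMap_orbitSetoid Λ
  have := compactSpace_quotient_orbitSetoid hcocpt
  have := hq.isQuotientMap.secondCountableTopology hq.isOpenMap
  borelize (Quotient (orbitSetoid Λ))
  obtain ⟨μ, hμfin, hμ⟩ := exists_measure_quotient_orbitSetoid (Λ := Λ) hwc hws hw0
  obtain ⟨K, hK, hKsymm⟩ := exists_lift_periodization hdisc hφ.continuous hφs hφrad
  obtain ⟨L, hL, hLsymm⟩ := exists_lift_periodization hdisc hψc hψs hψrad
  have hKconv := integralOp_comp_mk hdisc hwc hws hw hμ hφ.continuous hφs hφrad hK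
  have hLconv := integralOp_comp_mk hdisc hwc hws hw hμ hψc hψs hψrad hL
  have hmk (u : C(Quotient (orbitSetoid Λ), ℝ)) : Continuous (u ∘ Quotient.mk _) :=
    u.continuous.comp hq.continuous
  have hcomm (u : C(Quotient (orbitSetoid Λ), ℝ)) :
      integralOp μ K (integralEnd μ L (ContinuousMap.toLp 2 μ ℝ u)) =
        integralOp μ L (integralEnd μ K (ContinuousMap.toLp 2 μ ℝ u)) := by
    refine DFunLike.coe_injective (hq.surjective.injective_comp_right ?_)
    refine (hKconv (integralOp μ L _)).trans (Eq.trans ?_ (hLconv (integralOp μ K _)).symm)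
    rw [hLconv, hKconv]
    exact convolution_mul_right_comm (hmk u) hψc hψs hφ.continuous hφs
  obtain ⟨v, hv⟩ := exists_lift_orbitSetoid hf.continuous hfinv
  have hvf : v ∘ Quotient.mk _ = f := funext hv
  obtain ⟨p, hp, hpε⟩ := Metric.mem_closure_iff.1 (integralOp_integralEnd_mem_closure_span μ
    hKsymm hLsymm hcomm (ContinuousMap.toLp 2 μ ℝ v)) (ε / 3) (by positivity)
  have hsmooth : ∀ x, dist (integralOp μ K (integralEnd μ K (ContinuousMap.toLp 2 μ ℝ v))
      (Quotient.mk _ x)) (f x) ≤ 2 * (ε / 3) := by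
    intro x
    have hconv := hKconv (integralOp μ K (ContinuousMap.toLp 2 μ ℝ v))
    rw [hKconv v, hvf] at hconv
    refine (congrArg (dist · (f x)) (congrFun hconv x)).trans_le ?_
    refine dist_convolution_mul_le (by positivity) hφδ hφ0 hφint
      (continuous_convolution_of_hasCompactSupport hf.continuous hφ.continuous hφs) fun y hy => ?_
    have h₁ : dist ((f ⋆[ContinuousLinearMap.mul ℝ ℝ, volume] φ) y) (f y) ≤ ε / 3 :=
      dist_convolution_mul_le (by positivity) hφδ hφ0 hφint hf.continuous
        fun z hz => (hfδ z y hz).le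
    linarith [dist_triangle ((f ⋆[ContinuousLinearMap.mul ℝ ℝ, volume] φ) y) (f y) (f x),
      hfδ y x hy]
  obtain ⟨m, b, e, rfl⟩ := Submodule.mem_span_set'.1 hp
  choose a c ha h₁ h₂ using fun i => (e i).2
  have heig (i : Fin m) := coordLaplacian_eq_smul_of_convolution_eq (hmk (e i)) hφ hφs (ha i)
    (by rw [← hKconv, h₁]; rfl) (by rw [← hLconv, h₂]; rfl)
  refine ⟨m, fun i => b i • ((e i : C(Quotient (orbitSetoid Λ), ℝ)) ∘ Quotient.mk _),
    fun i => (a i)⁻¹ * c i, fun i => contDiff_const.smul (heig i).1, fun i x => ?_,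
    fun γ hγ x => ?_, fun x => ?_⟩
  · change coordLaplacian (b i • _) x = _
    rw [coordLaplacian_const_smul _ (heig i).1, (heig i).2, smul_comm]
    rfl
  · have hγx : Quotient.mk (orbitSetoid Λ) (γ x) = Quotient.mk _ x :=
      Quotient.sound ⟨γ⁻¹, inv_mem hγ, γ.symm_apply_apply x⟩
    simp only [Pi.smul_apply, Function.comp_apply, hγx]
  · have hx := (ContinuousMap.dist_apply_le_dist (Quotient.mk (orbitSetoid Λ) x)).trans hpε.le
    have hsum : (∑ i, b i • (e i : C(Quotient (orbitSetoid Λ), ℝ))) (Quotient.mk _ x) =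
        ∑ i, (b i • ((e i : C(Quotient (orbitSetoid Λ), ℝ)) ∘ Quotient.mk _)) x := by
      simp [ContinuousMap.sum_apply]
    rw [hsum] at hx
    rw [← Real.dist_eq]
    refine (dist_triangle_left _ _ _).trans ((add_le_add (hsmooth x) hx).trans_eq (by ring))
end
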